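/- Let t be a rooted tree. Then the number of labellings of t equals m(•;t), and the number of equivalence classes of labellings of t equals n(•;t). -/

import Mathlib

attribute [local instance] Classical.propDecidable

inductive PlanarTree : Type where
  | node : List PlanarTree → PlanarTree

namespace PlanarTree

/-- Isomorphism of (planar representatives of) rooted trees: the lists of
principal branches match up, pairwise isomorphically, after a permutation. -/
inductive Iso : PlanarTree → PlanarTree → Prop where
  | node {l m l' : List PlanarTree} :
      List.Perm l m → List.Forall₂ Iso m l' → Iso (node l) (node l')

/-- Number of vertices. -/
def size : PlanarTree → ℕ
  | node l => 1 + (l.attach.map fun c => size c.1).sum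
decreasing_by simp only [PlanarTree.node.sizeOf_spec]; exact Nat.lt_of_lt_of_le (List.sizeOf_lt_of_mem c.2) (Nat.le_add_left _ _)

mutual
  /-- All trees obtained by attaching the root of `s` by a new edge to some vertex. -/
  def graftList (s : PlanarTree) : PlanarTree → List PlanarTree
    | node l => node (s :: l) :: (graftAux s l).map node
  def graftAux (s : PlanarTree) : List PlanarTree → List (List PlanarTree)
    | [] => []
    | a :: l => ((graftList s a).map (· :: l)) ++ (graftAux s l).map (a :: ·)
end

/-- All trees obtained by adding a new edge and terminal vertex at some vertex. -/
def growList (t : PlanarTree) : List PlanarTree := graftList (node []) t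

mutual
  /-- All trees obtained by deleting one (non-root) terminal vertex. -/
  def pruneList : PlanarTree → List PlanarTree
    | node l => (pruneAux l).map node
  def pruneAux : List PlanarTree → List (List PlanarTree)
    | [] => []
    | a :: l =>
        (match a with | node [] => [l] | _ => []) ++
        ((pruneList a).map (· :: l)) ++ (pruneAux l).map (a :: ·)
end

mutual
  /-- All pairs (cut-off subtree, remaining tree) obtained by cutting one edge. -/
  def cutPairs : PlanarTree → List (PlanarTree × PlanarTree)
    | node l => (cutAux l).map fun x => (x.1, node x.2)
  def cutAux : List PlanarTree → List (PlanarTree × List PlanarTree)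
    | [] => []
    | a :: l =>
        (a, l) :: (((cutPairs a).map fun x => (x.1, x.2 :: l)) ++
          (cutAux l).map fun x => (x.1, a :: x.2))
end

/-- The order of the symmetry group `SG(t)`: the product over all vertices `v`
of the number of permutations of the branches at `v` exchanging isomorphic branches. -/
noncomputable def sg : PlanarTree → ℕ
  | node l =>
      (l.attach.map fun c => sg c.1).prod *
        Nat.card {σ : Equiv.Perm (Fin l.length) // ∀ i, Iso (l.get (σ i)) (l.get i)}
decreasing_by simp only [PlanarTree.node.sizeOf_spec]; exact Nat.lt_of_lt_of_le (List.sizeOf_lt_of_mem c.2) (Nat.le_add_left _ _)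

/-- Vertices of a planar tree, encoded as paths of child-indices from the root. -/
inductive IsVertex : PlanarTree → List ℕ → Prop where
  | root (t : PlanarTree) : IsVertex t []
  | child {l : List PlanarTree} {i : ℕ} {c : PlanarTree} {p : List ℕ} :
      l[i]? = some c → IsVertex c p → IsVertex (node l) (i :: p)

def Vertex (t : PlanarTree) : Type := {p : List ℕ // IsVertex t p}

/-- `v` lies strictly below `w` in the tree order (i.e. `w` is a proper ancestor of `v`). -/
def StrictBelow {t : PlanarTree} (v w : Vertex t) : Prop := w.1 <+: v.1 ∧ w.1 ≠ v.1

/-- A labelling of `t`. -/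
def Labelling (t : PlanarTree) : Type :=
  {f : Vertex t ≃ Fin t.size // ∀ v w, StrictBelow v w → f w < f v}

/-- Equivalence of labellings: they differ by an automorphism of the rooted tree. -/
def labelEquiv {t : PlanarTree} (f g : Labelling t) : Prop :=
  ∃ φ : Equiv.Perm (Vertex t),
    (∀ v w, StrictBelow (φ v) (φ w) ↔ StrictBelow v w) ∧ ∀ v, f.1 (φ v) = g.1 v

end PlanarTree

/-- Rooted trees: isomorphism classes of planar rooted trees. -/
instance planarSetoid : Setoid PlanarTree := Relation.EqvGen.setoid PlanarTree.Iso

def RTree : Type := Quotient planarSetoid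

namespace RTree

def mk (p : PlanarTree) : RTree := ⟦p⟧

/-- A chosen planar representative. -/
noncomputable def rep (T : RTree) : PlanarTree := Quotient.out T

noncomputable def size (T : RTree) : ℕ := T.rep.size

/-- The order of the symmetry (automorphism) group of `T`. -/
noncomputable def sg (T : RTree) : ℕ := T.rep.sg

/-- The one-vertex tree. -/
def bullet : RTree := mk (PlanarTree.node [])

/-- `Covers T T'` means `T ⊲ T'`: `T` is obtained from `T'` by deleting one terminal vertex. -/
noncomputable def Covers (T T' : RTree) : Prop :=
  ∃ p ∈ T'.rep.pruneList, mk p = T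

/-- `n(T;T')`: the number of vertices of `T` to which a new edge can be added to obtain `T'`. -/
noncomputable def nCov (T T' : RTree) : ℕ :=
  T.rep.growList.countP fun p => decide (mk p = T')

/-- `m(T;T')`: the number of (terminal) edges of `T'` which when removed leave `T`. -/
noncomputable def mCov (T T' : RTree) : ℕ :=
  T'.rep.pruneList.countP fun p => decide (mk p = T)

/-- `n(T₁,T₂;T₃)`: the number of vertices of `T₂` such that attaching the root of `T₁`
there by a new edge yields `T₃`. -/
noncomputable def nTri (T₁ T₂ T₃ : RTree) : ℕ :=
  (PlanarTree.graftList T₁.rep T₂.rep).countP fun p => decide (mk p = T₃)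

/-- `m(T₁,T₂;T₃)`: the number of edges of `T₃` whose removal cuts off a subtree
isomorphic to `T₁` leaving `T₂` (the piece containing the root). -/
noncomputable def mTri (T₁ T₂ T₃ : RTree) : ℕ :=
  T₃.rep.cutPairs.countP fun x => decide (mk x.1 = T₁ ∧ mk x.2 = T₂)

end RTree

section Ops

variable (k : Type*) [Semiring k]

/-- The element `𝔑(T) = Σ_{T ⊲ T'} n(T;T')·T'` of `k{T}`. -/
noncomputable def growF (T : RTree) : RTree →₀ k :=
  (T.rep.growList.map fun p => Finsupp.single (RTree.mk p) (1 : k)).sum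

/-- The element `𝔓(T) = Σ_{T' ⊲ T} m(T';T)·T'` of `k{T}`. -/
noncomputable def pruneF (T : RTree) : RTree →₀ k :=
  (T.rep.pruneList.map fun p => Finsupp.single (RTree.mk p) (1 : k)).sum

/-- The growth operator `𝔑` on `k{T}`. -/
noncomputable def Grow : Module.End k (RTree →₀ k) :=
  Finsupp.linearCombination k (growF k)

/-- The pruning operator `𝔓` on `k{T}`. -/
noncomputable def Prune : Module.End k (RTree →₀ k) :=
  Finsupp.linearCombination k (pruneF k)

/-- The operator `𝔇` on `k{T}`, `𝔇(t) = |t|·t`. -/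
noncomputable def Diag : Module.End k (RTree →₀ k) :=
  Finsupp.linearCombination k fun T => (T.size : k) • Finsupp.single T 1

/-- The inner product on `k{T}` determined by `(t,t') = |SG(t)|·δ_{t,t'}`. -/
noncomputable def innerT (x y : RTree →₀ k) : k :=
  x.sum fun T c => c * y T * (T.sg : k)

/-- Generalized multiplicity `n(T;T')`: coefficient of `T'` in `𝔑^{|T'|-|T|}(T)`. -/
noncomputable def nGen (T T' : RTree) : k :=
  ((Grow k ^ (T'.size - T.size)) (Finsupp.single T 1)) T'

/-- Generalized multiplicity `m(T;T')`: coefficient of `T` in `𝔓^{|T'|-|T|}(T')`. -/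
noncomputable def mGen (T T' : RTree) : k :=
  ((Prune k ^ (T'.size - T.size)) (Finsupp.single T' 1)) T

end Ops

section Kreimer

variable (k : Type*) [CommSemiring k]

/-- Kreimer's Hopf algebra `H_K`, as a commutative algebra: the free polynomial
algebra on rooted trees. -/
abbrev HK := MvPolynomial RTree k

/-- The inclusion `k{T} → H_K` of the linear span of the variables. -/
noncomputable def toHK : (RTree →₀ k) →ₗ[k] HK k :=
  Finsupp.linearCombination k fun T => MvPolynomial.X T

/-- The growth derivation `N` on `H_K`, with `N(t) = 𝔑(t)` for rooted trees `t`. -/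
noncomputable def ND : Derivation k (HK k) (HK k) :=
  MvPolynomial.mkDerivation k fun T => toHK k (growF k T)

/-- The pruning derivation `P` on `H_K`, with `P(t) = 𝔓(t)` for `|t| ≥ 2`, `P(•) = 1`. -/
noncomputable def PD : Derivation k (HK k) (HK k) :=
  MvPolynomial.mkDerivation k fun T =>
    if T = RTree.bullet then 1 else toHK k (pruneF k T)

/-- The grading derivation `D` on `H_K`, multiplying each homogeneous element of
degree `n` by `n`; it is the derivation with `D(t) = |t|·t` for rooted trees `t`. -/
noncomputable def DD : Derivation k (HK k) (HK k) :=
  MvPolynomial.mkDerivation k fun T => (T.size : k) • MvPolynomial.X T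

/-- The map `B₊ : H_K → k{T}` sending a forest to the tree obtained by attaching
all its roots to a new root vertex. -/
noncomputable def forestTree (d : RTree →₀ ℕ) : RTree :=
  RTree.mk (PlanarTree.node
    (d.support.toList.flatMap fun T => List.replicate (d T) T.rep))

noncomputable def Bplus (p : HK k) : RTree →₀ k :=
  ∑ d ∈ p.support, Finsupp.single (forestTree d) (MvPolynomial.coeff d p)

/-- The inner product on `H_K`. -/
noncomputable def innerHK (u v : HK k) : k := innerT k (Bplus k u) (Bplus k v)

/-- The degree-`n` homogeneous component of `H_K`. -/
noncomputable abbrev HKcomp (n : ℕ) : Submodule k (HK k) :=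
  MvPolynomial.weightedHomogeneousSubmodule k (fun T : RTree => T.size) n

/-- `T_i`: the number of rooted trees with `i+1` vertices. -/
noncomputable def Tcard (i : ℕ) : ℕ := Nat.card {T : RTree // T.size = i + 1}

end Kreimer

namespace PlanarTree

/-- Simultaneous induction on rooted trees and forests. -/
theorem tree_forest_induction {M : PlanarTree → Prop} {N : List PlanarTree → Prop}
    (node : ∀ l, N l → M (node l)) (nil : N []) (cons : ∀ a l, M a → N l → N (a :: l)) :
    (∀ p, M p) ∧ ∀ l, N l :=
  have h : ∀ p, M p := fun p =>
    PlanarTree.rec (motive_1 := M) (motive_2 := N) node nil cons p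
  ⟨h, fun l => List.rec nil (fun a l ih => cons a l (h a) ih) l⟩

section Relations

variable {V W V' W' : Type} {r : V → V → Prop} {s : W → W → Prop}
  {r' : V' → V' → Prop} {s' : W' → W' → Prop}

def withRoot (r : V → V → Prop) : Option V → Option V → Prop
  | some x, some y => r x y
  | some _, none => True
  | none, _ => False

/-- The relation obtained from `r` by adjoining a new element directly below `v`. -/
def addBelow (r : V → V → Prop) (v : V) : Option V → Option V → Prop
  | some x, some y => r x y
  | none, some y => y = v ∨ r v y
  | _, none => False

/-- The restriction of `r` to the complement of `w`. -/
def del (r : V → V → Prop) (w : V) : {v // v ≠ w} → {v // v ≠ w} → Prop :=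
  fun x y => r x.1 y.1

/-- Disjoint sums of relations respect isomorphism. -/
def liftRelCongr (e : r ≃r r') (f : s ≃r s') : Sum.LiftRel r s ≃r Sum.LiftRel r' s' where
  toEquiv := Equiv.sumCongr e.toEquiv f.toEquiv
  map_rel_iff' := by rintro (a | a) (b | b) <;> simp [e.map_rel_iff, f.map_rel_iff]

def withRootCongr (e : r ≃r r') : withRoot r ≃r withRoot r' where
  toEquiv := Equiv.optionCongr e.toEquiv
  map_rel_iff' := by rintro (_ | a) (_ | b) <;> simp [withRoot, e.map_rel_iff]

def addBelowCongr (e : r ≃r r') (v : V) : addBelow r v ≃r addBelow r' (e v) where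
  toEquiv := Equiv.optionCongr e.toEquiv
  map_rel_iff' := by rintro (_ | a) (_ | b) <;> simp [addBelow, e.map_rel_iff]

def delCongr (e : r ≃r r') (w : V) : del r w ≃r del r' (e w) where
  toEquiv := e.toEquiv.subtypeEquiv (by simp)
  map_rel_iff' := by rintro ⟨a, _⟩ ⟨b, _⟩; simp [del, e.map_rel_iff]

def liftRelComm (r : V → V → Prop) (s : W → W → Prop) :
    Sum.LiftRel r s ≃r Sum.LiftRel s r where
  toEquiv := Equiv.sumComm _ _
  map_rel_iff' := by rintro (a | a) (b | b) <;> simp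

def liftRelAssoc (r : V → V → Prop) (s : W → W → Prop) (r' : V' → V' → Prop) :
    Sum.LiftRel (Sum.LiftRel r s) r' ≃r Sum.LiftRel r (Sum.LiftRel s r') where
  toEquiv := Equiv.sumAssoc _ _ _
  map_rel_iff' := by rintro ((a | a) | a) ((b | b) | b) <;> simp

def liftRelLeftComm (r : V → V → Prop) (s : W → W → Prop) (r' : V' → V' → Prop) :
    Sum.LiftRel r (Sum.LiftRel s r') ≃r Sum.LiftRel s (Sum.LiftRel r r') :=
  ((liftRelAssoc r s r').symm.trans
    (liftRelCongr (liftRelComm r s) (RelIso.refl r'))).trans (liftRelAssoc s r r')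

def addBelowInl (r : V → V → Prop) (s : W → W → Prop) (v : V) :
    Sum.LiftRel (addBelow r v) s ≃r addBelow (Sum.LiftRel r s) (Sum.inl v) where
  toFun := fun
    | .inl none => none
    | .inl (some x) => some (.inl x)
    | .inr y => some (.inr y)
  invFun := fun
    | none => .inl none
    | some (.inl x) => .inl (some x)
    | some (.inr y) => .inr y
  left_inv := by rintro ((_ | _) | _) <;> rfl
  right_inv := by rintro (_ | _ | _) <;> rfl
  map_rel_iff' := by rintro ((_ | _) | _) ((_ | _) | _) <;> simp [addBelow]

def addBelowInr (r : V → V → Prop) (s : W → W → Prop) (w : W) :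
    Sum.LiftRel r (addBelow s w) ≃r addBelow (Sum.LiftRel r s) (Sum.inr w) where
  toFun := fun
    | .inr none => none
    | .inr (some x) => some (.inr x)
    | .inl y => some (.inl y)
  invFun := fun
    | none => .inr none
    | some (.inr x) => .inr (some x)
    | some (.inl y) => .inl y
  left_inv := by rintro (_ | (_ | _)) <;> rfl
  right_inv := by rintro (_ | _ | _) <;> rfl
  map_rel_iff' := by rintro (_ | (_ | _)) (_ | (_ | _)) <;> simp [addBelow]

def addBelowSome (r : V → V → Prop) (v : V) :
    withRoot (addBelow r v) ≃r addBelow (withRoot r) (some v) where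
  toFun := fun
    | none => some none
    | some none => none
    | some (some x) => some (some x)
  invFun := fun
    | some none => none
    | none => some none
    | some (some x) => some (some x)
  left_inv := by rintro (_ | _ | _) <;> rfl
  right_inv := by rintro (_ | _ | _) <;> rfl
  map_rel_iff' := by rintro (_ | _ | _) (_ | _ | _) <;> simp [addBelow, withRoot]

def addBelowNone (s : W → W → Prop) [Unique V] (hr : ∀ x y, ¬ r x y) :
    withRoot (Sum.LiftRel r s) ≃r addBelow (withRoot s) none where
  toFun := fun
    | none => some none
    | some (.inl _) => none
    | some (.inr x) => some (some x)
  invFun := fun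
    | some none => none
    | none => some (.inl default)
    | some (some x) => some (.inr x)
  left_inv := by rintro (_ | _ | _) <;> simp [Unique.eq_default]
  right_inv := by rintro (_ | _ | _) <;> rfl
  map_rel_iff' := by rintro (_ | _ | _) (_ | _ | _) <;> simp [addBelow, withRoot, hr]

def delInl (r : V → V → Prop) (s : W → W → Prop) (v : V) :
    Sum.LiftRel (del r v) s ≃r del (Sum.LiftRel r s) (Sum.inl v) where
  toFun := fun
    | .inl x => ⟨.inl x.1, by simpa using x.2⟩
    | .inr y => ⟨.inr y, by simp⟩
  invFun := fun
    | ⟨.inl x, h⟩ => .inl ⟨x, by simpa using h⟩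
    | ⟨.inr y, _⟩ => .inr y
  left_inv := by rintro (_ | _) <;> rfl
  right_inv := by rintro ⟨_ | _, _⟩ <;> rfl
  map_rel_iff' := by rintro (_ | _) (_ | _) <;> simp [del]

def delInr (r : V → V → Prop) (s : W → W → Prop) (w : W) :
    Sum.LiftRel r (del s w) ≃r del (Sum.LiftRel r s) (Sum.inr w) where
  toFun := fun
    | .inr x => ⟨.inr x.1, by simpa using x.2⟩
    | .inl y => ⟨.inl y, by simp⟩
  invFun := fun
    | ⟨.inr x, h⟩ => .inr ⟨x, by simpa using h⟩
    | ⟨.inl y, _⟩ => .inl y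
  left_inv := by rintro (_ | _) <;> rfl
  right_inv := by rintro ⟨_ | _, _⟩ <;> rfl
  map_rel_iff' := by rintro (_ | _) (_ | _) <;> simp [del]

def delSome (r : V → V → Prop) (v : V) :
    withRoot (del r v) ≃r del (withRoot r) (some v) where
  toFun := fun
    | none => ⟨none, by simp⟩
    | some x => ⟨some x.1, by simpa using x.2⟩
  invFun := fun
    | ⟨none, _⟩ => none
    | ⟨some x, h⟩ => some ⟨x, by simpa using h⟩
  left_inv := by rintro (_ | _) <;> rfl
  right_inv := by rintro ⟨_ | _, _⟩ <;> rfl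
  map_rel_iff' := by rintro (_ | _) (_ | _) <;> simp [del, withRoot]

def delUnique (r : V → V → Prop) (s : W → W → Prop) [Unique V] :
    s ≃r del (Sum.LiftRel r s) (Sum.inl default) where
  toFun := fun x => ⟨.inr x, by simp⟩
  invFun := fun
    | ⟨.inl x, h⟩ => absurd (congrArg Sum.inl (Unique.eq_default x)) h
    | ⟨.inr y, _⟩ => y
  left_inv := by intro; rfl
  right_inv := by
    rintro ⟨x | _, h⟩
    · exact absurd (congrArg Sum.inl (Unique.eq_default x)) h
    · rfl
  map_rel_iff' := by simp [del]

end Relations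

/-- The vertices of a planar forest. -/
def ForestVertex : List PlanarTree → Type
  | [] => Empty
  | a :: l => Vertex a ⊕ ForestVertex l

/-- The order relation on the vertices of a planar forest. -/
def ForestBelow : (l : List PlanarTree) → ForestVertex l → ForestVertex l → Prop
  | [] => fun _ _ => False
  | a :: l => Sum.LiftRel (StrictBelow (t := a)) (ForestBelow l)

/-- The non-root vertices of `node l`, encoded as paths. -/
def BranchVertex (l : List PlanarTree) : Type :=
  {x : ℕ × List ℕ // ∃ c, l[x.1]? = some c ∧ IsVertex c x.2}

def BranchBelow (l : List PlanarTree) (x y : BranchVertex l) : Prop :=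
  x.1.1 = y.1.1 ∧ y.1.2 <+: x.1.2 ∧ y.1.2 ≠ x.1.2

def branchNil : ForestBelow [] ≃r BranchBelow [] where
  toFun := Empty.elim
  invFun := fun x => absurd x.2 (by simp)
  left_inv := fun x => x.elim
  right_inv := fun x => absurd x.2 (by simp)
  map_rel_iff' := fun {x} => x.elim

def branchCons (a : PlanarTree) (l : List PlanarTree) :
    Sum.LiftRel (StrictBelow (t := a)) (BranchBelow l) ≃r BranchBelow (a :: l) where
  toFun := fun
    | .inl x => ⟨(0, x.1), a, rfl, x.2⟩
    | .inr x => ⟨(x.1.1 + 1, x.1.2), by simpa using x.2⟩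
  invFun := fun
    | ⟨(0, p), h⟩ => .inl ⟨p, by simpa using h⟩
    | ⟨(i + 1, p), h⟩ => .inr ⟨(i, p), by simpa using h⟩
  left_inv := by rintro (_ | _) <;> rfl
  right_inv := by rintro ⟨⟨_ | _, _⟩, _⟩ <;> rfl
  map_rel_iff' := by rintro (_ | _) (_ | _) <;> simp [BranchBelow, StrictBelow]

def forestBranch : (l : List PlanarTree) → ForestBelow l ≃r BranchBelow l
  | [] => branchNil
  | a :: l => (liftRelCongr (RelIso.refl _) (forestBranch l)).trans (branchCons a l)

def branchRoot (l : List PlanarTree) :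
    StrictBelow (t := node l) ≃r withRoot (BranchBelow l) where
  toFun := fun
    | ⟨[], _⟩ => none
    | ⟨i :: p, h⟩ => some ⟨(i, p), by cases h with | child h₁ h₂ => exact ⟨_, h₁, h₂⟩⟩
  invFun := fun
    | none => ⟨[], IsVertex.root _⟩
    | some x => ⟨x.1.1 :: x.1.2, by obtain ⟨c, h₁, h₂⟩ := x.2; exact IsVertex.child h₁ h₂⟩
  left_inv := by rintro ⟨_ | _, _⟩ <;> rfl
  right_inv := by rintro (_ | _) <;> rfl
  map_rel_iff' := by
    rintro ⟨_ | _, _⟩ ⟨_ | _, _⟩ <;> simp [withRoot, BranchBelow, StrictBelow]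
    grind

/-- The vertices of `node l` are its root and the vertices of the forest `l`. -/
def nodeIso (l : List PlanarTree) : StrictBelow (t := node l) ≃r withRoot (ForestBelow l) :=
  (branchRoot l).trans (withRootCongr (forestBranch l).symm)

section Enumeration

variable {α β α' β' : Type} {P : β → α → Prop} {P' : β' → α' → Prop}
  {S S' : α → Prop} {L M : List β}

/-- The list `L` corresponds under `P` to a repetition-free list of the elements of `S`. -/
def Enumerates (L : List β) (P : β → α → Prop) (S : α → Prop) : Prop :=
  ∃ vs : List α, vs.Nodup ∧ (∀ v, v ∈ vs ↔ S v) ∧ List.Forall₂ P L vs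

theorem Enumerates.congr (h : Enumerates L P S) (hS : ∀ v, S v ↔ S' v) :
    Enumerates L P S' := by
  obtain rfl : S = S' := funext fun v => propext (hS v)
  exact h

theorem Enumerates.nil (hS : ∀ v, ¬ S v) : Enumerates [] P S :=
  ⟨[], by simp, by simpa using hS, by simp⟩

theorem Enumerates.singleton {b : β} {a : α} (h : P b a) : Enumerates [b] P (· = a) :=
  ⟨[a], by simp, by simp, by simpa using h⟩

theorem Enumerates.append (h : Enumerates L P S) (h' : Enumerates M P S')
    (hd : ∀ v, S v → ¬ S' v) : Enumerates (L ++ M) P (fun v => S v ∨ S' v) := by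
  obtain ⟨vs, h₁, h₂, h₃⟩ := h
  obtain ⟨vs', h₁', h₂', h₃'⟩ := h'
  refine ⟨vs ++ vs', ?_, by simp [h₂, h₂'], List.rel_append h₃ h₃'⟩
  rw [List.nodup_append]
  exact ⟨h₁, h₁', fun a ha b hb hab => hd a ((h₂ a).1 ha) ((h₂' a).1 (hab ▸ hb))⟩

theorem Enumerates.map (h : Enumerates L P S) {g : α → α'} (hg : Function.Injective g)
    {f : β → β'} (hP : ∀ b a, P b a → P' (f b) (g a)) :
    Enumerates (L.map f) P' (fun a' => ∃ a, S a ∧ g a = a') := by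
  obtain ⟨vs, h₁, h₂, h₃⟩ := h
  refine ⟨vs.map g, h₁.map hg, by simp [h₂], ?_⟩
  rw [List.forall₂_map_left_iff, List.forall₂_map_right_iff]
  exact h₃.imp fun b a => hP b a

theorem Enumerates.sum_eq [Fintype α] [DecidablePred S] {A : Type*} [AddCommMonoid A]
    (h : Enumerates L P S) (F : β → A) (G : α → A) (hFG : ∀ b a, P b a → F b = G a) :
    (L.map F).sum = ∑ a with S a, G a := by
  obtain ⟨vs, h₁, h₂, h₃⟩ := h
  have key : L.map F = vs.map G := by
    clear h₁ h₂
    induction h₃ with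
    | nil => rfl
    | cons h _ ih => simp [hFG _ _ h, ih]
  rw [key, ← List.sum_toFinset _ h₁]
  exact Finset.sum_congr (by ext; simp [h₂]) fun _ _ => rfl

end Enumeration

/-- `r` is isomorphic to the order relation of the tree `q`. -/
abbrev Realizes {V : Type} (q : PlanarTree) (r : V → V → Prop) : Prop :=
  Nonempty (StrictBelow (t := q) ≃r r)

abbrev ForestRealizes {V : Type} (l : List PlanarTree) (r : V → V → Prop) : Prop :=
  Nonempty (ForestBelow l ≃r r)

theorem Realizes.node {V : Type} {l : List PlanarTree} {r : V → V → Prop}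
    (h : ForestRealizes l r) : Realizes (node l) (withRoot r) :=
  h.map fun e => (nodeIso l).trans (withRootCongr e)

instance : Unique (Vertex (node [])) where
  default := ⟨[], IsVertex.root _⟩
  uniq := by
    rintro ⟨_ | _, h⟩
    · rfl
    · cases h with | child h₁ h₂ => simp at h₁

theorem not_below_single (x y : Vertex (node [])) : ¬ StrictBelow x y := by
  rw [Unique.eq_default x, Unique.eq_default y]
  exact fun h => h.2 rfl

/-- Growing `p` adds a new vertex below each vertex of `p`, once each. -/
theorem enumerates_growList (p : PlanarTree) :
    Enumerates (growList p) (fun q v => Realizes q (addBelow (StrictBelow (t := p)) v))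
      (fun _ => True) := by
  refine (tree_forest_induction (M := fun p =>
    Enumerates (growList p) (fun q v => Realizes q (addBelow (StrictBelow (t := p)) v))
      (fun _ => True)) (N := fun l =>
    Enumerates (graftAux (PlanarTree.node []) l)
      (fun q v => ForestRealizes q (addBelow (ForestBelow l) v)) (fun _ => True))
    ?_ ?_ ?_).1 p
  · intro l hl
    rw [growList, graftList]
    have h₀ : Realizes (PlanarTree.node (PlanarTree.node [] :: l))
        (addBelow (StrictBelow (t := PlanarTree.node l)) ((nodeIso l).symm none)) :=
      ⟨((nodeIso (PlanarTree.node [] :: l)).trans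
        (addBelowNone (ForestBelow l) not_below_single)).trans
        (addBelowCongr (nodeIso l).symm none)⟩
    have h₁ := hl.map (P' := fun q v =>
        Realizes q (addBelow (StrictBelow (t := PlanarTree.node l)) v))
      (g := fun x => (nodeIso l).symm (some x)) (f := PlanarTree.node)
      (fun x y h => by simpa using h)
      (fun b a ⟨e⟩ => ⟨(((nodeIso b).trans (withRootCongr e)).trans (addBelowSome _ a)).trans
        (addBelowCongr (nodeIso l).symm (some a))⟩)
    refine ((Enumerates.singleton (P := fun q v =>
      Realizes q (addBelow (StrictBelow (t := PlanarTree.node l)) v)) h₀).append h₁ ?_).congr ?_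
    · rintro v rfl ⟨a, -, h⟩
      simp at h
    · intro v
      obtain ⟨x, rfl⟩ := (nodeIso l).symm.surjective v
      rcases x with _ | x <;> simp
  · exact Enumerates.nil fun v => v.elim
  · intro a l ha hl
    rw [graftAux]
    have h₀ := ha.map (P' := fun q v => ForestRealizes q (addBelow (ForestBelow (a :: l)) v))
      (g := Sum.inl) (f := (· :: l)) Sum.inl_injective
      (fun b a ⟨e⟩ => ⟨(liftRelCongr e (RelIso.refl _)).trans (addBelowInl _ _ a)⟩)
    have h₁ := hl.map (P' := fun q v => ForestRealizes q (addBelow (ForestBelow (a :: l)) v))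
      (g := Sum.inr) (f := (a :: ·)) Sum.inr_injective
      (fun b a ⟨e⟩ => ⟨(liftRelCongr (RelIso.refl _) e).trans (addBelowInr _ _ a)⟩)
    refine (h₀.append h₁ ?_).congr ?_
    · rintro v ⟨x, -, rfl⟩ ⟨y, -, h⟩
      simp at h
    · rintro (x | x)
      · exact iff_of_true (Or.inl ⟨x, trivial, rfl⟩) trivial
      · exact iff_of_true (Or.inr ⟨x, trivial, rfl⟩) trivial

theorem pruneAux_cons (a : PlanarTree) (l : List PlanarTree) :
    pruneAux (a :: l) = (if a = node [] then [l] else []) ++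
      (pruneList a).map (· :: l) ++ (pruneAux l).map (a :: ·) := by
  rcases a with ⟨_ | _⟩ <;> simp [pruneAux]

/-- Pruning `p` deletes each terminal vertex of `p` other than the root, once each. -/
theorem enumerates_pruneList (p : PlanarTree) :
    Enumerates (pruneList p) (fun q w => Realizes q (del (StrictBelow (t := p)) w))
      (fun w => (∀ x, ¬ StrictBelow x w) ∧ ∃ y, StrictBelow w y) := by
  refine (tree_forest_induction (M := fun p =>
    Enumerates (pruneList p) (fun q w => Realizes q (del (StrictBelow (t := p)) w))
      (fun w => (∀ x, ¬ StrictBelow x w) ∧ ∃ y, StrictBelow w y)) (N := fun l =>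
    Enumerates (pruneAux l) (fun q w => ForestRealizes q (del (ForestBelow l) w))
      (fun w => ∀ x, ¬ ForestBelow l x w)) ?_ ?_ ?_).1 p
  · intro l hl
    rw [pruneList]
    have h₁ := hl.map (P' := fun q v =>
        Realizes q (del (StrictBelow (t := PlanarTree.node l)) v))
      (g := fun x => (nodeIso l).symm (some x)) (f := PlanarTree.node)
      (fun x y h => by simpa using h)
      (fun b a ⟨e⟩ => ⟨(((nodeIso b).trans (withRootCongr e)).trans (delSome _ a)).trans
        (delCongr (nodeIso l).symm (some a))⟩)
    refine h₁.congr fun v => ?_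
    obtain ⟨x, rfl⟩ := (nodeIso l).symm.surjective v
    rw [(nodeIso l).symm.surjective.forall, (nodeIso l).symm.surjective.exists]
    simp only [(nodeIso l).symm.map_rel_iff, (nodeIso l).symm.injective.eq_iff]
    rcases x with _ | x
    · simp [withRoot]
    · simp [withRoot, Option.exists, Option.forall]
  · exact Enumerates.nil fun v => v.elim
  · intro a l ha hl
    rw [pruneAux_cons]
    have h₀ := ha.map (P' := fun q v => ForestRealizes q (del (ForestBelow (a :: l)) v))
      (g := Sum.inl) (f := (· :: l)) Sum.inl_injective
      (fun b a ⟨e⟩ => ⟨(liftRelCongr e (RelIso.refl _)).trans (delInl _ _ a)⟩)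
    have h₁ := hl.map (P' := fun q v => ForestRealizes q (del (ForestBelow (a :: l)) v))
      (g := Sum.inr) (f := (a :: ·)) Sum.inr_injective
      (fun b a ⟨e⟩ => ⟨(liftRelCongr (RelIso.refl _) e).trans (delInr _ _ a)⟩)
    have h₂ : Enumerates (if a = PlanarTree.node [] then [l] else [])
        (fun q v => ForestRealizes q (del (ForestBelow (a :: l)) v))
        (fun w => ∃ v : Vertex a, (∀ x, ¬ StrictBelow x v) ∧ (∀ x, ¬ StrictBelow v x) ∧
          Sum.inl v = w) := by
      obtain ⟨_ | ⟨b, m⟩⟩ := a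
      · rw [if_pos rfl]
        refine (Enumerates.singleton (a := Sum.inl default) ?_).congr ?_
        · exact ⟨delUnique _ _⟩
        · intro v
          constructor
          · rintro rfl
            exact ⟨default, fun x => not_below_single _ _, fun x => not_below_single _ _, rfl⟩
          · rintro ⟨v, -, -, rfl⟩
            rw [Unique.eq_default v]
      · rw [if_neg (by simp)]
        refine Enumerates.nil ?_
        rintro w ⟨v, h, h', -⟩
        obtain ⟨x, rfl⟩ := (nodeIso (b :: m)).symm.surjective v
        rcases x with _ | x
        · refine h ((nodeIso (b :: m)).symm
            (some (Sum.inl ⟨[], IsVertex.root _⟩))) ?_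
          rw [(nodeIso (b :: m)).symm.map_rel_iff]
          trivial
        · refine h' ((nodeIso (b :: m)).symm none) ?_
          rw [(nodeIso (b :: m)).symm.map_rel_iff]
          trivial
    refine ((h₂.append h₀ ?_).append h₁ ?_).congr ?_
    · rintro v ⟨x, -, h, rfl⟩ ⟨y, ⟨-, z, hz⟩, h'⟩
      rw [Sum.inl_injective h'] at hz
      exact h _ hz
    · rintro v (⟨x, -, -, rfl⟩ | ⟨x, -, rfl⟩) ⟨y, -, h⟩ <;> simp at h
    · intro v
      constructor
      · rintro ((⟨w, h, -, rfl⟩ | ⟨w, ⟨h, -⟩, rfl⟩) | ⟨w, h, rfl⟩) (x | x) hx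
        · exact h x (Sum.liftRel_inl_inl.1 hx)
        · exact Sum.not_liftRel_inr_inl hx
        · exact h x (Sum.liftRel_inl_inl.1 hx)
        · exact Sum.not_liftRel_inr_inl hx
        · exact Sum.not_liftRel_inl_inr hx
        · exact h x (Sum.liftRel_inr_inr.1 hx)
      · intro h
        rcases v with w | w
        · have hw : ∀ x, ¬ StrictBelow x w := fun x hx => h (Sum.inl x) (Sum.LiftRel.inl hx)
          by_cases h' : ∃ y, StrictBelow w y
          · exact .inl (.inr ⟨w, ⟨hw, h'⟩, rfl⟩)
          · exact .inl (.inl ⟨w, hw, not_exists.1 h', rfl⟩)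
        · exact .inr ⟨w, fun x hx => h (Sum.inr x) (Sum.LiftRel.inr hx), rfl⟩

/-- A non-root vertex has a parent. -/
theorem exists_parent (p : PlanarTree) (w : Vertex p) (hw : ∃ y, StrictBelow w y) :
    ∃ v, ∀ y, StrictBelow w y ↔ y = v ∨ StrictBelow v y := by
  refine (tree_forest_induction (M := fun p => ∀ w : Vertex p, (∃ y, StrictBelow w y) →
      ∃ v, ∀ y, StrictBelow w y ↔ y = v ∨ StrictBelow v y) (N := fun l =>
      ∀ w, (∃ y, ForestBelow l w y) →
        ∃ v, ∀ y, ForestBelow l w y ↔ y = v ∨ ForestBelow l v y) ?_ ?_ ?_).1 p w hw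
  · intro l hl w
    obtain ⟨w, rfl⟩ := (nodeIso l).symm.surjective w
    simp only [(nodeIso l).symm.surjective.exists, (nodeIso l).symm.surjective.forall,
      (nodeIso l).symm.map_rel_iff, (nodeIso l).symm.injective.eq_iff]
    rcases w with _ | w
    · simp [withRoot]
    · intro _
      by_cases h : ∃ y, ForestBelow l w y
      · obtain ⟨v, hv⟩ := hl w h
        exact ⟨some v, by simp [Option.forall, withRoot, hv]⟩
      · exact ⟨none, by simpa [Option.forall, withRoot] using h⟩
  · exact fun w => w.elim
  · rintro a l ha hl (w | w) ⟨y | y, hy⟩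
    · obtain ⟨v, hv⟩ := ha w ⟨y, Sum.liftRel_inl_inl.1 hy⟩
      refine ⟨Sum.inl v, ?_⟩
      rintro (z | z) <;> simp only [ForestBelow, Sum.liftRel_inl_inl,
        Sum.not_liftRel_inl_inr, hv, or_false, false_iff]
      · exact or_congr_left Sum.inl_injective.eq_iff.symm
      · exact Sum.inr_ne_inl
    · exact absurd hy Sum.not_liftRel_inl_inr
    · exact absurd hy Sum.not_liftRel_inr_inl
    · obtain ⟨v, hv⟩ := hl w ⟨y, Sum.liftRel_inr_inr.1 hy⟩
      refine ⟨Sum.inr v, ?_⟩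
      rintro (z | z) <;> simp only [ForestBelow, Sum.liftRel_inr_inr,
        Sum.not_liftRel_inr_inl, hv, or_false, false_iff]
      · exact Sum.inl_ne_inr
      · exact or_congr_left Sum.inr_injective.eq_iff.symm

theorem size_node (l : List PlanarTree) : (node l).size = 1 + (l.map size).sum := by
  rw [size]
  simp

theorem finite_and_card_vertex (p : PlanarTree) :
    Finite (Vertex p) ∧ Nat.card (Vertex p) = p.size := by
  refine (tree_forest_induction (M := fun p => Finite (Vertex p) ∧ Nat.card (Vertex p) = p.size)
    (N := fun l => Finite (ForestVertex l) ∧ Nat.card (ForestVertex l) = (l.map size).sum)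
    ?_ ?_ ?_).1 p
  · rintro l ⟨_, hl⟩
    refine ⟨Finite.of_equiv _ (nodeIso l).symm.toEquiv, ?_⟩
    rw [Nat.card_congr (nodeIso l).toEquiv, Finite.card_option, hl, size_node, add_comm]
  · exact ⟨inferInstanceAs (Finite Empty), by simp [ForestVertex]⟩
  · rintro a l ⟨_, ha⟩ ⟨_, hl⟩
    refine ⟨inferInstanceAs (Finite (Vertex a ⊕ ForestVertex l)), ?_⟩
    rw [List.map_cons, List.sum_cons, ← ha, ← hl]
    exact Nat.card_sum

instance (p : PlanarTree) : Finite (Vertex p) := (finite_and_card_vertex p).1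

noncomputable instance (p : PlanarTree) : Fintype (Vertex p) := Fintype.ofFinite _

theorem card_vertex (p : PlanarTree) : Nat.card (Vertex p) = p.size :=
  (finite_and_card_vertex p).2

theorem size_eq_one_iff {p : PlanarTree} : p.size = 1 ↔ p = node [] := by
  refine ⟨fun h => ?_, by rintro rfl; simp [size_node]⟩
  rcases p with ⟨_ | ⟨⟨a⟩, l⟩⟩
  · rfl
  · simp [size_node] at h

theorem size_pos (p : PlanarTree) : 0 < p.size := by
  rcases p with ⟨l⟩
  rw [size_node]
  omega

def rootVertex (p : PlanarTree) : Vertex p := ⟨[], IsVertex.root p⟩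

theorem below_root_iff {p : PlanarTree} (x : Vertex p) :
    StrictBelow x (rootVertex p) ↔ x ≠ rootVertex p := by
  have h : x = rootVertex p ↔ [] = x.1 := Subtype.ext_iff.trans eq_comm
  rw [Ne, h]
  exact and_iff_right ⟨x.1, rfl⟩

theorem not_root_below {p : PlanarTree} (y : Vertex p) : ¬ StrictBelow (rootVertex p) y := by
  simp [StrictBelow, rootVertex]

theorem eq_root_or_below {p : PlanarTree} (x : Vertex p) :
    x = rootVertex p ∨ StrictBelow x (rootVertex p) := by
  rw [below_root_iff]
  exact em _

theorem Iso.refl (p : PlanarTree) : Iso p p :=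
  (tree_forest_induction (M := fun p => Iso p p) (N := fun l => List.Forall₂ Iso l l)
    (fun l hl => Iso.node (List.Perm.refl l) hl) List.Forall₂.nil
    (fun _ _ => List.Forall₂.cons)).1 p

theorem mk_eq_of_iso {p q : PlanarTree} (h : Iso p q) : RTree.mk p = RTree.mk q :=
  Quotient.sound (Relation.EqvGen.rel _ _ h)

theorem mk_node_perm {l m : List PlanarTree} (h : l.Perm m) :
    RTree.mk (node l) = RTree.mk (node m) :=
  mk_eq_of_iso (Iso.node h (List.forall₂_same.2 fun a _ => Iso.refl a))

theorem mk_node_cons {a b : PlanarTree} (h : RTree.mk a = RTree.mk b) (l : List PlanarTree) :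
    RTree.mk (node (a :: l)) = RTree.mk (node (b :: l)) := by
  replace h : Relation.EqvGen Iso a b := Quotient.exact h
  induction h with
  | rel a b h =>
    exact mk_eq_of_iso (Iso.node (List.Perm.refl _)
      (List.Forall₂.cons h (List.forall₂_same.2 fun a _ => Iso.refl a)))
  | refl a => rfl
  | symm a b _ ih => exact ih.symm
  | trans a b c _ _ ih₁ ih₂ => exact ih₁.trans ih₂

theorem forestRealizes_of_perm {l m : List PlanarTree} (h : l.Perm m) :
    ForestRealizes l (ForestBelow m) := by
  induction h with
  | nil => exact ⟨RelIso.refl _⟩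
  | cons a _ ih => exact ih.map fun e => liftRelCongr (RelIso.refl _) e
  | swap a b l => exact ⟨liftRelLeftComm _ _ _⟩
  | trans _ _ ih₁ ih₂ =>
    obtain ⟨e₁⟩ := ih₁
    obtain ⟨e₂⟩ := ih₂
    exact ⟨e₁.trans e₂⟩

theorem Iso.realizes {p q : PlanarTree} (h : Iso p q) : Realizes p (StrictBelow (t := q)) := by
  suffices H : ∀ q p, Iso p q → Realizes p (StrictBelow (t := q)) from H q p h
  refine (tree_forest_induction (M := fun q => ∀ p, Iso p q → Realizes p (StrictBelow (t := q)))
    (N := fun l => ∀ m, List.Forall₂ Iso m l → ForestRealizes m (ForestBelow l))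
    ?_ ?_ ?_).1
  · intro l hl p h
    cases h with
    | node h₁ h₂ =>
      obtain ⟨e₁⟩ := forestRealizes_of_perm h₁
      obtain ⟨e₂⟩ := hl _ h₂
      exact ⟨((nodeIso _).trans (withRootCongr (e₁.trans e₂))).trans (nodeIso l).symm⟩
  · rintro m h
    cases h
    exact ⟨RelIso.refl _⟩
  · intro a l ha hl m h
    cases h with
    | cons h₁ h₂ =>
      obtain ⟨e₁⟩ := ha _ h₁
      obtain ⟨e₂⟩ := hl _ h₂
      exact ⟨liftRelCongr e₁ e₂⟩

theorem realizes_of_mk_eq {p q : PlanarTree} (h : RTree.mk p = RTree.mk q) :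
    Realizes p (StrictBelow (t := q)) := by
  replace h : Relation.EqvGen Iso p q := Quotient.exact h
  induction h with
  | rel a b h => exact h.realizes
  | refl a => exact ⟨RelIso.refl _⟩
  | symm a b _ ih => exact ih.map RelIso.symm
  | trans a b c _ _ ih₁ ih₂ =>
    obtain ⟨e₁⟩ := ih₁
    obtain ⟨e₂⟩ := ih₂
    exact ⟨e₁.trans e₂⟩

section Cancel

variable {V W V' W' : Type} {r : V → V → Prop} {s : W → W → Prop}
  {r' : V' → V' → Prop} {s' : W' → W' → Prop}

theorem withRoot_cancel (e : withRoot r ≃r withRoot r') : Nonempty (r ≃r r') := by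
  have h₀ : e none = none := by
    rcases h : e none with _ | x
    · rfl
    · have : withRoot r none (e.symm none) := by
        rw [← e.map_rel_iff, h, e.apply_symm_apply]
        trivial
      exact this.elim
  have h₁ : ∀ x, some (e.toEquiv.removeNone x) = e (some x) := fun x => by
    refine Equiv.removeNone_some e.toEquiv ?_
    rcases h : e.toEquiv (some x) with _ | y
    · exact absurd (e.injective (h.trans h₀.symm)) (by simp)
    · exact ⟨y, rfl⟩
  refine ⟨⟨e.toEquiv.removeNone, fun {a b} => ?_⟩⟩
  have := e.map_rel_iff (a := some a) (b := some b)
  rwa [← h₁, ← h₁] at this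

theorem liftRel_apply_inl (e : Sum.LiftRel r s ≃r Sum.LiftRel r' s') {t : V} {t' : V'}
    (ht : ∀ x, x = t ∨ r x t) (he : e (Sum.inl t) = Sum.inl t') (x : V) :
    ∃ y, e (Sum.inl x) = Sum.inl y := by
  rcases ht x with rfl | h
  · exact ⟨t', he⟩
  · have := e.map_rel_iff.2 (Sum.liftRel_inl_inl.2 h : Sum.LiftRel r s _ _)
    rw [he] at this
    rcases h' : e (Sum.inl x) with y | y
    · exact ⟨y, rfl⟩
    · rw [h'] at this
      exact absurd this Sum.not_liftRel_inr_inl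

/-- An isomorphism of disjoint sums that matches the greatest elements of the left summands
induces isomorphisms of both summands. -/
theorem liftRel_cancel (e : Sum.LiftRel r s ≃r Sum.LiftRel r' s') {t : V} {t' : V'}
    (ht : ∀ x, x = t ∨ r x t) (ht' : ∀ x, x = t' ∨ r' x t')
    (he : e (Sum.inl t) = Sum.inl t') : Nonempty (r ≃r r') ∧ Nonempty (s ≃r s') := by
  have he' : e.symm (Sum.inl t') = Sum.inl t := by rw [← he, e.symm_apply_apply]
  have hf := liftRel_apply_inl e ht he
  have hg := liftRel_apply_inl e.symm ht' he'
  have hf' : ∀ x, ∃ y, e (Sum.inr x) = Sum.inr y := fun x => by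
    rcases h : e (Sum.inr x) with y | y
    · obtain ⟨z, hz⟩ := hg y
      rw [← h, e.symm_apply_apply] at hz
      cases hz
    · exact ⟨y, rfl⟩
  have hg' : ∀ x, ∃ y, e.symm (Sum.inr x) = Sum.inr y := fun x => by
    rcases h : e.symm (Sum.inr x) with y | y
    · obtain ⟨z, hz⟩ := hf y
      rw [← h, e.apply_symm_apply] at hz
      cases hz
    · exact ⟨y, rfl⟩
  choose f hf using hf
  choose g hg using hg
  choose f' hf' using hf'
  choose g' hg' using hg'
  refine ⟨⟨⟨⟨f, g, fun x => ?_, fun x => ?_⟩, fun {a b} => ?_⟩⟩,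
    ⟨⟨⟨f', g', fun x => ?_, fun x => ?_⟩, fun {a b} => ?_⟩⟩⟩
  · exact Sum.inl_injective (by rw [← hg, ← hf, e.symm_apply_apply])
  · exact Sum.inl_injective (by rw [← hf, ← hg, e.apply_symm_apply])
  · have := e.map_rel_iff (a := Sum.inl a) (b := Sum.inl b)
    simpa [hf] using this
  · exact Sum.inr_injective (by rw [← hg', ← hf', e.symm_apply_apply])
  · exact Sum.inr_injective (by rw [← hf', ← hg', e.apply_symm_apply])
  · have := e.map_rel_iff (a := Sum.inr a) (b := Sum.inr b)
    simpa [hf'] using this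

end Cancel

/-- A maximal vertex of a forest is the root of one of its trees. -/
theorem exists_perm_cons_of_maximal (l : List PlanarTree) (x : ForestVertex l)
    (hx : ∀ y, ¬ ForestBelow l x y) :
    ∃ b m, l.Perm (b :: m) ∧
      ∃ e : ForestBelow l ≃r Sum.LiftRel (StrictBelow (t := b)) (ForestBelow m),
        e x = Sum.inl (rootVertex b) := by
  induction l with
  | nil => exact x.elim
  | cons c l ih =>
    rcases x with x | x
    · refine ⟨c, l, List.Perm.refl _, RelIso.refl _, ?_⟩
      rcases eq_root_or_below x with rfl | h
      · rfl
      · exact absurd (Sum.LiftRel.inl h) (hx (Sum.inl (rootVertex c)))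
    · obtain ⟨b, m, hp, e, he⟩ := ih x fun y h => hx (Sum.inr y) (Sum.LiftRel.inr h)
      refine ⟨b, c :: m, (hp.cons c).trans (List.Perm.swap _ _ _),
        (liftRelCongr (RelIso.refl _) e).trans (liftRelLeftComm _ _ _), ?_⟩
      change liftRelLeftComm _ _ _ (Sum.inr (e x)) = _
      rw [he]
      rfl

theorem mk_eq_of_realizes {p q : PlanarTree} (h : Realizes p (StrictBelow (t := q))) :
    RTree.mk p = RTree.mk q := by
  suffices H : ∀ p q, Realizes p (StrictBelow (t := q)) → RTree.mk p = RTree.mk q from H p q h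
  refine (tree_forest_induction
    (M := fun p => ∀ q, Realizes p (StrictBelow (t := q)) → RTree.mk p = RTree.mk q)
    (N := fun l => ∀ m, ForestRealizes l (ForestBelow m) →
      ∀ c, RTree.mk (node (l ++ c)) = RTree.mk (node (m ++ c))) ?_ ?_ ?_).1
  · rintro l hl ⟨m⟩ ⟨e⟩
    simpa using hl m (withRoot_cancel (((nodeIso l).symm.trans e).trans (nodeIso m))) []
  · rintro (_ | ⟨b, m⟩) ⟨e⟩ c
    · rfl
    · exact (e.symm (Sum.inl (rootVertex b))).elim
  · rintro a l ha hl m ⟨e⟩ c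
    let x : ForestVertex (a :: l) := Sum.inl (rootVertex a)
    obtain ⟨b, m', hp, e', he'⟩ := exists_perm_cons_of_maximal m (e x) (fun y h => by
        obtain ⟨y, rfl⟩ := e.surjective y
        rw [e.map_rel_iff] at h
        rcases y with y | y
        · exact not_root_below y (Sum.liftRel_inl_inl.1 h)
        · exact Sum.not_liftRel_inl_inr h)
    obtain ⟨h₁, h₂⟩ := liftRel_cancel (r := StrictBelow (t := a)) (s := ForestBelow l)
      (e.trans e') eq_root_or_below eq_root_or_below he'
    calc RTree.mk (node (a :: (l ++ c))) = RTree.mk (node (b :: (l ++ c))) :=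
          mk_node_cons (ha b h₁) _
      _ = RTree.mk (node (l ++ b :: c)) := mk_node_perm List.perm_middle.symm
      _ = RTree.mk (node (m' ++ b :: c)) := hl m' h₂ _
      _ = RTree.mk (node (m ++ c)) :=
          mk_node_perm (List.perm_middle.trans (hp.symm.append_right c))

/-- Two planar trees represent the same rooted tree exactly when their vertex orders are
isomorphic. -/
theorem mk_eq_mk_iff {p q : PlanarTree} :
    RTree.mk p = RTree.mk q ↔ Realizes p (StrictBelow (t := q)) :=
  ⟨realizes_of_mk_eq, mk_eq_of_realizes⟩

theorem mk_rep (T : RTree) : RTree.mk T.rep = T := Quotient.out_eq T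

theorem rep_realizes (p : PlanarTree) : Realizes (RTree.mk p).rep (StrictBelow (t := p)) :=
  realizes_of_mk_eq (mk_rep _)

theorem Realizes.size_eq {V : Type} {p : PlanarTree} {r : V → V → Prop} (h : Realizes p r) :
    p.size = Nat.card V := by
  obtain ⟨e⟩ := h
  rw [← card_vertex, Nat.card_congr e.toEquiv]

theorem size_mk (p : PlanarTree) : (RTree.mk p).size = p.size := by
  rw [RTree.size, (rep_realizes p).size_eq, card_vertex]

theorem size_bullet : RTree.bullet.size = 1 := by
  rw [RTree.bullet, size_mk, size_eq_one_iff]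

theorem exists_above_of_minimal {p : PlanarTree} (hp : 2 ≤ p.size) {w : Vertex p}
    (hw : ∀ x, ¬ StrictBelow x w) : ∃ y, StrictBelow w y := by
  rcases eq_root_or_below w with rfl | h
  · have : Subsingleton (Vertex p) :=
      ⟨fun x y => ((eq_root_or_below x).resolve_right (hw x)).trans
        ((eq_root_or_below y).resolve_right (hw y)).symm⟩
    have := Finite.card_le_one_iff_subsingleton.2 this
    rw [card_vertex] at this
    omega
  · exact ⟨_, h⟩

section Labellings

variable {V W : Type} {r : V → V → Prop} {s : W → W → Prop} {n : ℕ}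

/-- The order-reversing bijections from `r` to `Fin n`. -/
def RelLabelling (r : V → V → Prop) (n : ℕ) : Type :=
  {f : V ≃ Fin n // ∀ v w, r v w → f w < f v}

instance [Finite V] : Finite (RelLabelling r n) :=
  inferInstanceAs (Finite {f : V ≃ Fin n // ∀ v w, r v w → f w < f v})

def relLabellingCongr (e : r ≃r s) : RelLabelling r n ≃ RelLabelling s n :=
  (Equiv.equivCongr e.toEquiv (Equiv.refl _)).subtypeEquiv fun f => by
    have h : ∀ x, e.toEquiv.symm (e x) = x := e.toEquiv.symm_apply_apply
    simp [e.surjective.forall, e.map_rel_iff, h]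

theorem card_relLabelling_one [Unique V] (hr : ∀ x y, ¬ r x y) :
    Nat.card (RelLabelling r 1) = 1 := by
  rw [Nat.card_eq_one_iff_unique]
  exact ⟨⟨fun f g => Subtype.ext (Equiv.ext fun x => Subsingleton.elim _ _)⟩,
    ⟨⟨Equiv.ofUnique V (Fin 1), fun v w h => (hr v w h).elim⟩⟩⟩

/-- Extend a labelling of the complement of `w` by giving `w` the greatest label. -/
noncomputable def extendLabel (w : V) (g : {v // v ≠ w} ≃ Fin n) : V ≃ Fin (n + 1) :=
  ((Equiv.optionSubtypeNe w).symm.trans (Equiv.optionCongr g)).trans finSuccEquivLast.symm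

theorem extendLabel_self (w : V) (g : {v // v ≠ w} ≃ Fin n) :
    extendLabel w g w = Fin.last n := by
  simp [extendLabel]

theorem extendLabel_of_ne {w v : V} (g : {v // v ≠ w} ≃ Fin n) (h : v ≠ w) :
    extendLabel w g v = (g ⟨v, h⟩).castSucc := by
  simp [extendLabel, Equiv.optionSubtypeNe_symm_of_ne h]

theorem card_relLabelling_fiber {w : V} (hw : ∀ x, ¬ r x w) :
    Nat.card {f : RelLabelling r (n + 1) // f.1.symm (Fin.last n) = w} =
      Nat.card (RelLabelling (del r w) n) := by
  have hmem : ∀ g : RelLabelling (del r w) n, ∀ a b, r a b →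
      extendLabel w g.1 b < extendLabel w g.1 a := by
    intro g a b hab
    have hb : b ≠ w := by rintro rfl; exact hw a hab
    by_cases ha : a = w
    · rw [ha, extendLabel_self, extendLabel_of_ne _ hb]
      exact Fin.castSucc_lt_last _
    · rw [extendLabel_of_ne _ ha, extendLabel_of_ne _ hb, Fin.castSucc_lt_castSucc_iff]
      exact g.2 ⟨a, ha⟩ ⟨b, hb⟩ hab
  refine (Nat.card_congr (Equiv.ofBijective
    (fun g : RelLabelling (del r w) n =>
      (⟨⟨extendLabel w g.1, hmem g⟩,
        by rw [Equiv.symm_apply_eq, extendLabel_self]⟩ :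
        {f : RelLabelling r (n + 1) // f.1.symm (Fin.last n) = w})) ⟨?_, ?_⟩)).symm
  · intro g g' h
    have h' : extendLabel w g.1 = extendLabel w g'.1 :=
      congrArg (fun f : {f : RelLabelling r (n + 1) // f.1.symm (Fin.last n) = w} => f.1.1) h
    refine Subtype.ext (Equiv.ext fun ⟨v, hv⟩ => ?_)
    have := DFunLike.congr_fun h' v
    rwa [extendLabel_of_ne _ hv, extendLabel_of_ne _ hv, Fin.castSucc_inj] at this
  · rintro ⟨⟨f, hf⟩, hfw⟩
    have hfw : f w = Fin.last n := ((Equiv.symm_apply_eq f).1 hfw).symm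
    let g : {v // v ≠ w} ≃ Fin n :=
      (f.subtypeEquiv (q := fun x => x ≠ Fin.last n) fun v => by
        rw [← hfw, f.injective.ne_iff]).trans (finSuccAboveEquiv (Fin.last n)).symm
    have hg : ∀ v (hv : v ≠ w), (g ⟨v, hv⟩).castSucc = f v := fun v hv => by
      rw [← Fin.succAbove_last]
      exact congrArg Subtype.val ((finSuccAboveEquiv (Fin.last n)).apply_symm_apply
        ⟨f v, by rwa [← hfw, f.injective.ne_iff]⟩)
    refine ⟨⟨g, fun a b hab => ?_⟩, Subtype.ext (Subtype.ext (Equiv.ext fun v => ?_))⟩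
    · rw [← Fin.castSucc_lt_castSucc_iff, hg, hg]
      exact hf _ _ hab
    · by_cases hv : v = w
      · subst hv
        exact (extendLabel_self v g).trans hfw.symm
      · exact (extendLabel_of_ne g hv).trans (hg v hv)

/-- Labellings are counted by the vertex that carries the greatest label. -/
theorem card_relLabelling_succ [Fintype V] (r : V → V → Prop) (n : ℕ) :
    Nat.card (RelLabelling r (n + 1)) =
      ∑ w with ∀ x, ¬ r x w, Nat.card (RelLabelling (del r w) n) := by
  rw [← Nat.card_congr (Equiv.sigmaFiberEquiv
    fun f : RelLabelling r (n + 1) => f.1.symm (Fin.last n)), Nat.card_sigma, Finset.sum_filter]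
  refine Finset.sum_congr rfl fun w _ => ?_
  split_ifs with hw
  · exact card_relLabelling_fiber hw
  · have : IsEmpty {f : RelLabelling r (n + 1) // f.1.symm (Fin.last n) = w} := by
      refine ⟨fun ⟨f, hf⟩ => hw fun x hx => ?_⟩
      have := f.2 x w hx
      rw [(Equiv.symm_apply_eq f.1).1 hf |>.symm] at this
      exact absurd this (Fin.le_last _).not_gt
    exact Nat.card_of_isEmpty

theorem card_labelling {p : PlanarTree} (h : p.size = n) :
    Nat.card (Labelling p) = Nat.card (RelLabelling (StrictBelow (t := p)) n) := by
  subst h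
  rfl

end Labellings

theorem prune_pow_apply_bullet (k : Type*) [Semiring k] (n : ℕ) (p : PlanarTree)
    (hp : p.size = n + 1) :
    (Prune k ^ n) (Finsupp.single (RTree.mk p) 1) RTree.bullet =
      (Nat.card (Labelling p) : k) := by
  induction n generalizing p with
  | zero =>
    obtain rfl := size_eq_one_iff.1 hp
    rw [card_labelling hp, card_relLabelling_one not_below_single]
    simp [RTree.bullet]
  | succ n ih =>
    let F : (RTree →₀ k) →+ k :=
      (Finsupp.applyAddHom RTree.bullet).comp (Prune k ^ n : Module.End k _).toAddMonoidHom
    have hF : (Prune k ^ (n + 1)) (Finsupp.single (RTree.mk p) 1) RTree.bullet =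
        ((RTree.mk p).rep.pruneList.map fun q => F (Finsupp.single (RTree.mk q) 1)).sum := by
      rw [pow_succ, Module.End.mul_apply, Prune, Finsupp.linearCombination_single, one_smul,
        pruneF]
      change F _ = _
      rw [map_list_sum, List.map_map]
      rfl
    obtain ⟨e⟩ := rep_realizes p
    have hs : (RTree.mk p).rep.size = n + 2 := (size_mk p).trans hp
    have hc : ∀ w : Vertex (RTree.mk p).rep, Nat.card {v // v ≠ w} = n + 1 := fun w => by
      have := card_vertex (RTree.mk p).rep
      rw [Nat.card_congr (Equiv.optionSubtypeNe w).symm, Finite.card_option] at this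
      omega
    rw [hF, card_labelling hp, ← Nat.card_congr (relLabellingCongr e), card_relLabelling_succ,
      (enumerates_pruneList _).sum_eq _
        (fun w => (Nat.card (RelLabelling (del StrictBelow w) (n + 1)) : k)) ?_, Nat.cast_sum]
    · refine Finset.sum_congr (Finset.filter_congr fun w _ => ?_) fun _ _ => rfl
      exact and_iff_left_of_imp (exists_above_of_minimal (by omega))
    · rintro q w ⟨e'⟩
      have hq : q.size = n + 1 := (Realizes.size_eq ⟨e'⟩).trans (hc w)
      rw [← Nat.card_congr (relLabellingCongr e'), ← card_labelling hq]
      exact ih q hq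

/-- The relation on `Fin (m + 1)` obtained from `r` by adding the last element below `v`. -/
def growRel {m : ℕ} (r : Fin m → Fin m → Prop) (v : Fin m) : Fin (m + 1) → Fin (m + 1) → Prop :=
  fun i j => addBelow r v (finSuccEquivLast i) (finSuccEquivLast j)

section GrowRel

variable {m : ℕ} (r : Fin m → Fin m → Prop) (v : Fin m)

def growRelIso : growRel r v ≃r addBelow r v where
  toEquiv := finSuccEquivLast
  map_rel_iff' := Iff.rfl

@[simp]
theorem growRel_castSucc_castSucc (i j : Fin m) :
    growRel r v i.castSucc j.castSucc ↔ r i j := by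
  simp [growRel, addBelow]

@[simp]
theorem growRel_last_castSucc (j : Fin m) :
    growRel r v (Fin.last m) j.castSucc ↔ j = v ∨ r v j := by
  simp [growRel, addBelow]

@[simp]
theorem not_growRel_last (i : Fin (m + 1)) : ¬ growRel r v i (Fin.last m) := by
  rcases h : finSuccEquivLast i with _ | _ <;> simp [growRel, addBelow, h]

end GrowRel

/-- The tree orders on `Fin m` in which the root is least and labels increase downwards. -/
noncomputable def increasingOrders (m : ℕ) : Finset (Fin m → Fin m → Prop) :=
  {r | (∀ i j, r i j → j < i) ∧ ∃ q, Realizes q r}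

theorem mem_increasingOrders {m : ℕ} {r : Fin m → Fin m → Prop} :
    r ∈ increasingOrders m ↔ (∀ i j, r i j → j < i) ∧ ∃ q, Realizes q r := by
  simp [increasingOrders]

/-- The rooted tree whose order is `r` (the one-vertex tree if there is none). -/
noncomputable def treeOf {V : Type} (r : V → V → Prop) : RTree :=
  if h : ∃ q, Realizes q r then RTree.mk h.choose else RTree.bullet

theorem treeOf_eq {V : Type} {r : V → V → Prop} {q : PlanarTree} (h : Realizes q r) :
    treeOf r = RTree.mk q := by
  have h' : ∃ q, Realizes q r := ⟨q, h⟩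
  rw [treeOf, dif_pos h']
  obtain ⟨e⟩ := h
  obtain ⟨e'⟩ := h'.choose_spec
  exact mk_eq_of_realizes ⟨e'.trans e.symm⟩

theorem treeOf_eq_mk_iff {m : ℕ} {r : Fin m → Fin m → Prop} (hr : r ∈ increasingOrders m)
    {p : PlanarTree} : treeOf r = RTree.mk p ↔ Realizes p r := by
  refine ⟨fun h => ?_, treeOf_eq⟩
  obtain ⟨q, ⟨e⟩⟩ := (mem_increasingOrders.1 hr).2
  obtain ⟨e'⟩ := mk_eq_mk_iff.1 (h.symm.trans (treeOf_eq ⟨e⟩))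
  exact ⟨e'.trans e⟩

theorem Enumerates.exists_left {α β : Type} {L : List β} {P : β → α → Prop} {S : α → Prop}
    (h : Enumerates L P S) {a : α} (ha : S a) : ∃ b, P b a := by
  obtain ⟨vs, -, h₂, h₃⟩ := h
  rw [← h₂] at ha
  clear h₂
  induction h₃ with
  | nil => simp at ha
  | cons h _ ih =>
    rcases List.mem_cons.1 ha with rfl | h'
    · exact ⟨_, h⟩
    · exact ih h'

theorem growRel_mem {m : ℕ} {r : Fin m → Fin m → Prop} (hr : r ∈ increasingOrders m)
    (v : Fin m) : growRel r v ∈ increasingOrders (m + 1) := by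
  rw [mem_increasingOrders] at hr ⊢
  obtain ⟨hi, q, ⟨e⟩⟩ := hr
  constructor
  · intro i j h
    induction j using Fin.lastCases with
    | last => exact absurd h (not_growRel_last r v i)
    | cast j =>
      induction i using Fin.lastCases with
      | last => exact Fin.castSucc_lt_last j
      | cast i =>
        exact Fin.castSucc_lt_castSucc_iff.2 (hi i j ((growRel_castSucc_castSucc r v i j).1 h))
  · obtain ⟨q', ⟨e'⟩⟩ := (enumerates_growList q).exists_left (a := e.symm v) trivial
    have e'' := addBelowCongr e (e.symm v)
    rw [e.apply_symm_apply] at e''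
    exact ⟨q', ⟨(e'.trans e'').trans (growRelIso r v).symm⟩⟩

theorem growRel_injective {m : ℕ} {r r' : Fin m → Fin m → Prop} {v v' : Fin m}
    (hr : ∀ i j, r i j → j < i) (h : growRel r v = growRel r' v') : r = r' ∧ v = v' := by
  obtain rfl : r = r' := by
    ext i j
    rw [← growRel_castSucc_castSucc r v, h, growRel_castSucc_castSucc]
  refine ⟨rfl, ?_⟩
  have h₁ : v = v' ∨ r v' v := by
    rw [← growRel_last_castSucc, ← h, growRel_last_castSucc]
    exact .inl rfl
  have h₂ : v' = v ∨ r v v' := by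
    rw [← growRel_last_castSucc, h, growRel_last_castSucc]
    exact .inl rfl
  rcases h₁ with h₁ | h₁
  · exact h₁
  · rcases h₂ with h₂ | h₂
    · exact h₂.symm
    · exact absurd (hr _ _ h₁) (hr _ _ h₂).not_gt

theorem exists_growRel_eq {m : ℕ} (hm : 1 ≤ m) {r : Fin (m + 1) → Fin (m + 1) → Prop}
    (hr : r ∈ increasingOrders (m + 1)) :
    ∃ r' ∈ increasingOrders m, ∃ v, growRel r' v = r := by
  obtain ⟨hi, q, ⟨e⟩⟩ := mem_increasingOrders.1 hr
  have hlast : ∀ i, ¬ r i (Fin.last m) := fun i h => (hi _ _ h).not_ge (Fin.le_last i)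
  have hmin : ∀ x, ¬ StrictBelow x (e.symm (Fin.last m)) := fun x h => by
    rw [← e.map_rel_iff, e.apply_symm_apply] at h
    exact hlast _ h
  have hq : q.size = m + 1 := by
    rw [Realizes.size_eq ⟨e⟩, Nat.card_fin]
  have habove := exists_above_of_minimal (by omega) hmin
  obtain ⟨v, hv⟩ := exists_parent q _ habove
  obtain ⟨v, rfl⟩ := e.symm.surjective v
  simp only [e.symm.surjective.forall, e.symm.map_rel_iff, e.symm.injective.eq_iff] at hv
  have hv' : v ≠ Fin.last m := by
    rintro rfl
    exact hlast _ ((hv _).2 (.inl rfl))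
  obtain ⟨u, rfl⟩ := Fin.exists_castSucc_eq.2 hv'
  refine ⟨fun i j => r i.castSucc j.castSucc, ?_, u, ?_⟩
  · refine mem_increasingOrders.2 ⟨fun i j h => by simpa using hi _ _ h, ?_⟩
    obtain ⟨q', ⟨e'⟩⟩ := (enumerates_pruneList q).exists_left ⟨hmin, habove⟩
    have e'' := delCongr e (e.symm (Fin.last m))
    rw [e.apply_symm_apply] at e''
    let E : (fun i j : Fin m => r i.castSucc j.castSucc) ≃r del r (Fin.last m) :=
      { toEquiv := finSuccAboveEquiv (Fin.last m)
        map_rel_iff' := by simp [del, finSuccAboveEquiv] }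
    exact ⟨q', ⟨(e'.trans e'').trans E.symm⟩⟩
  · ext i j
    induction j using Fin.lastCases with
    | last => exact iff_of_false (not_growRel_last _ _ _) (hlast i)
    | cast j =>
      induction i using Fin.lastCases with
      | last => rw [growRel_last_castSucc, hv, Fin.castSucc_inj]
      | cast i => rw [growRel_castSucc_castSucc]

theorem growF_treeOf (k : Type*) [Semiring k] {m : ℕ} {r : Fin m → Fin m → Prop}
    (hr : r ∈ increasingOrders m) :
    growF k (treeOf r) = ∑ v, Finsupp.single (treeOf (growRel r v)) (1 : k) := by
  obtain ⟨q, ⟨e₀⟩⟩ := (mem_increasingOrders.1 hr).2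
  rw [treeOf_eq ⟨e₀⟩, growF]
  obtain ⟨e₁⟩ := rep_realizes q
  have e := e₁.trans e₀
  rw [(enumerates_growList _).sum_eq _
    (fun v => Finsupp.single (treeOf (growRel r (e v))) (1 : k)) ?_]
  · rw [Finset.filter_true]
    exact e.toEquiv.sum_comp fun v => Finsupp.single (treeOf (growRel r v)) (1 : k)
  · rintro q' v ⟨e'⟩
    rw [treeOf_eq ⟨(e'.trans (addBelowCongr e v)).trans (growRelIso r (e v)).symm⟩]

theorem increasingOrders_one : increasingOrders 1 = {fun _ _ => False} := by
  have hu : ∀ r : Fin 1 → Fin 1 → Prop, (∀ i j, r i j → j < i) → r = fun _ _ => False := by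
    intro r hr
    ext i j
    refine iff_of_false (fun h => ?_) id
    have := hr i j h
    omega
  ext r
  rw [mem_increasingOrders, Finset.mem_singleton]
  refine ⟨fun h => hu r h.1, ?_⟩
  rintro rfl
  exact ⟨fun _ _ h => h.elim, node [], ⟨⟨Equiv.ofUnique _ _,
    fun {x y} => iff_of_false id (not_below_single x y)⟩⟩⟩

/-- Iterated growth from the one-vertex tree lists the increasing tree orders. -/
theorem grow_pow_bullet (k : Type*) [Semiring k] (n : ℕ) :
    (Grow k ^ n) (Finsupp.single RTree.bullet 1) =
      ∑ r ∈ increasingOrders (n + 1), Finsupp.single (treeOf r) (1 : k) := by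
  induction n with
  | zero =>
    have h : Realizes (node []) (fun _ _ : Fin 1 => False) :=
      ⟨⟨Equiv.ofUnique _ _, fun {x y} => iff_of_false id (not_below_single x y)⟩⟩
    rw [pow_zero, increasingOrders_one, Finset.sum_singleton, treeOf_eq h]
    rfl
  | succ n ih =>
    rw [pow_succ', Module.End.mul_apply, ih, map_sum]
    have h : ∀ r ∈ increasingOrders (n + 1),
        Grow k (Finsupp.single (treeOf r) 1) =
          ∑ v, Finsupp.single (treeOf (growRel r v)) (1 : k) := fun r hr => by
      rw [Grow, Finsupp.linearCombination_single, one_smul, growF_treeOf k hr]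
    rw [Finset.sum_congr rfl h, ← Finset.sum_product']
    refine Finset.sum_nbij (fun x => growRel x.1 x.2) ?_ ?_ ?_ fun _ _ => rfl
    · intro x hx
      exact growRel_mem (Finset.mem_product.1 hx).1 _
    · intro x hx y _ hxy
      obtain ⟨h₁, h₂⟩ := growRel_injective
        (mem_increasingOrders.1 (Finset.mem_product.1 hx).1).1 hxy
      exact Prod.ext h₁ h₂
    · intro r hr
      obtain ⟨r₀, hr₀, v, rfl⟩ := exists_growRel_eq (by omega) hr
      exact ⟨(r₀, v), by simpa using hr₀, rfl⟩

/-- The order on labels induced by a labelling. -/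
def labelOrder {p : PlanarTree} (f : Labelling p) : Fin p.size → Fin p.size → Prop :=
  fun i j => StrictBelow (f.1.symm i) (f.1.symm j)

def labelOrderIso {p : PlanarTree} (f : Labelling p) :
    StrictBelow (t := p) ≃r labelOrder f where
  toEquiv := f.1
  map_rel_iff' := by simp [labelOrder]

theorem labelEquiv_iff {p : PlanarTree} (f g : Labelling p) :
    labelEquiv f g ↔ labelOrder f = labelOrder g := by
  constructor
  · rintro ⟨φ, hφ, h⟩
    have h' : ∀ i, f.1.symm i = φ (g.1.symm i) := fun i => by
      rw [Equiv.symm_apply_eq, h, Equiv.apply_symm_apply]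
    ext i j
    rw [labelOrder, labelOrder, h', h', hφ]
  · intro h
    refine ⟨g.1.trans f.1.symm, fun v w => ?_, fun v => by simp⟩
    change labelOrder f (g.1 v) (g.1 w) ↔ _
    rw [h]
    exact (labelOrderIso g).map_rel_iff

theorem card_quot_labelEquiv (p : PlanarTree) :
    Nat.card (Quot (@labelEquiv p)) =
      ((increasingOrders p.size).filter fun r => Realizes p r).card := by
  rw [← Nat.card_eq_finsetCard]
  have hmem : ∀ f : Labelling p,
      labelOrder f ∈ (increasingOrders p.size).filter fun r => Realizes p r := fun f => by
    rw [Finset.mem_filter, mem_increasingOrders]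
    refine ⟨⟨fun i j h => ?_, p, ⟨labelOrderIso f⟩⟩, ⟨labelOrderIso f⟩⟩
    simpa using f.2 _ _ h
  refine Nat.card_congr (Equiv.ofBijective (Quot.lift (fun f => ⟨labelOrder f, hmem f⟩)
    fun f g h => Subtype.ext ((labelEquiv_iff f g).1 h)) ⟨?_, ?_⟩)
  · rintro ⟨f⟩ ⟨g⟩ h
    exact Quot.sound ((labelEquiv_iff f g).2 (congrArg Subtype.val h))
  · rintro ⟨r, hr⟩
    rw [Finset.mem_filter, mem_increasingOrders] at hr
    obtain ⟨⟨hi, -⟩, ⟨e⟩⟩ := hr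
    refine ⟨Quot.mk _ ⟨e.toEquiv, fun v w h => hi _ _ (e.map_rel_iff.2 h)⟩,
      Subtype.ext ?_⟩
    ext i j
    change StrictBelow (e.symm i) (e.symm j) ↔ r i j
    exact e.symm.map_rel_iff

end PlanarTree

/-- A rooted tree `t` has `m(•;t)` labellings, and `n(•;t)` labellings
modulo equivalence (equivalence classes counted as the classes of `labelEquiv`). -/
theorem stmt8 (k : Type*) [Field k] [CharZero k] (p : PlanarTree) :
    ((Nat.card (PlanarTree.Labelling p) : ℕ) : k) = mGen k RTree.bullet (RTree.mk p)
    ∧ ((Nat.card (Quot (@PlanarTree.labelEquiv p)) : ℕ) : k)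
        = nGen k RTree.bullet (RTree.mk p) := by
  have hp : p.size - 1 + 1 = p.size := Nat.sub_add_cancel p.size_pos
  rw [mGen, nGen, PlanarTree.size_mk, PlanarTree.size_bullet]
  refine ⟨(PlanarTree.prune_pow_apply_bullet k _ p hp.symm).symm, ?_⟩
  rw [PlanarTree.grow_pow_bullet, hp, PlanarTree.card_quot_labelEquiv, Finsupp.finsetSum_apply,
    Finset.card_filter, Nat.cast_sum]
  refine Finset.sum_congr rfl fun r hr => ?_
  rw [Finsupp.single_apply]
  by_cases h : PlanarTree.Realizes p r
  · rw [if_pos h, if_pos ((PlanarTree.treeOf_eq_mk_iff hr).2 h), Nat.cast_one]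
  · rw [if_neg h, if_neg (mt (PlanarTree.treeOf_eq_mk_iff hr).1 h), Nat.cast_zero]
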